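/- arXiv:1612.08367 — 3 statements merged into one kernel-verified Lean document; each statement's English description precedes it below -/
import Mathlib

section
/- Let c, θ : ℝ → ℝ be functions with c continuous (or at least such that the angle rates below exist), and let Ω, I, σ : ℝ → ℝ be differentiable with sin I(t) ≠ 0, satisfying Ω̇ = c sin(θ+σ)/sin I, İ = c cos(θ+σ), σ̇ = −Ω̇ cos I. Define λ₁ = sin(I/2) cos((Ω−σ)/2), λ₂ = sin(I/2) sin((Ω−σ)/2), λ₃ = cos(I/2) sin((Ω+σ)/2), λ₄ = cos(I/2) cos((Ω+σ)/2). Then the λᵢ are differentiable and satisfy λ̇₁ = (c/2)(λ₄ cos θ − λ₃ sin θ), λ̇₂ = (c/2)(λ₄ sin θ + λ₃ cos θ), λ̇₃ = (c/2)(λ₁ sin θ − λ₂ cos θ), λ̇₄ = −(c/2)(λ₁ cos θ + λ₂ sin θ). -/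
/-- The Euler redundant parameters of the 3-1-3 Euler angles `Ω, I, σ` of the ideal frame
satisfy the differential equations
`λ̇₁ = (c/2)(λ₄ cos θ − λ₃ sin θ)`, `λ̇₂ = (c/2)(λ₄ sin θ + λ₃ cos θ)`,
`λ̇₃ = (c/2)(λ₁ sin θ − λ₂ cos θ)`, `λ̇₄ = −(c/2)(λ₁ cos θ + λ₂ sin θ)`. -/
theorem eulerParameters_hasDerivAt
    (c θ : ℝ → ℝ) (Ω I σ : ℝ → ℝ)
    (hΩd : Differentiable ℝ Ω) (hId : Differentiable ℝ I) (hσd : Differentiable ℝ σ)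
    (hsin : ∀ t, Real.sin (I t) ≠ 0)
    (hΩ : ∀ t, deriv Ω t = c t * Real.sin (θ t + σ t) / Real.sin (I t))
    (hI : ∀ t, deriv I t = c t * Real.cos (θ t + σ t))
    (hσ : ∀ t, deriv σ t = -(deriv Ω t * Real.cos (I t)))
    (l1 l2 l3 l4 : ℝ → ℝ)
    (h1 : l1 = fun t => Real.sin (I t / 2) * Real.cos ((Ω t - σ t) / 2))
    (h2 : l2 = fun t => Real.sin (I t / 2) * Real.sin ((Ω t - σ t) / 2))
    (h3 : l3 = fun t => Real.cos (I t / 2) * Real.sin ((Ω t + σ t) / 2))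
    (h4 : l4 = fun t => Real.cos (I t / 2) * Real.cos ((Ω t + σ t) / 2)) :
    ∀ t,
      HasDerivAt l1 (c t / 2 * (l4 t * Real.cos (θ t) - l3 t * Real.sin (θ t))) t ∧
      HasDerivAt l2 (c t / 2 * (l4 t * Real.sin (θ t) + l3 t * Real.cos (θ t))) t ∧
      HasDerivAt l3 (c t / 2 * (l1 t * Real.sin (θ t) - l2 t * Real.cos (θ t))) t ∧
      HasDerivAt l4 (-(c t / 2 * (l1 t * Real.cos (θ t) + l2 t * Real.sin (θ t)))) t := by
  intro t
  have hsin_eq : Real.sin (I t) = 2 * Real.sin (I t / 2) * Real.cos (I t / 2) := by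
    rw [← Real.sin_two_mul, mul_div_cancel₀ _ two_ne_zero]
  have hcos_eq : Real.cos (I t) = 2 * Real.cos (I t / 2) ^ 2 - 1 := by
    rw [← Real.cos_two_mul, mul_div_cancel₀ _ two_ne_zero]
  have hne := hsin t
  rw [hsin_eq] at hne
  have hs : Real.sin (I t / 2) ≠ 0 := fun h => hne (by simp [h])
  have hk : Real.cos (I t / 2) ≠ 0 := fun h => hne (by simp [h])
  have hhalf : HasDerivAt (fun t => I t / 2) (c t * Real.cos (θ t + σ t) / 2) t :=
    hI t ▸ (hId t).hasDerivAt.div_const 2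
  have hdiff : HasDerivAt (fun t => (Ω t - σ t) / 2)
      (c t * Real.sin (θ t + σ t) * Real.cos (I t / 2) / (2 * Real.sin (I t / 2))) t := by
    refine (((hΩd t).hasDerivAt.sub (hσd t).hasDerivAt).div_const 2).congr_deriv ?_
    rw [hσ, hΩ, hsin_eq, hcos_eq]
    field_simp
    ring
  have hsum : HasDerivAt (fun t => (Ω t + σ t) / 2)
      (c t * Real.sin (θ t + σ t) * Real.sin (I t / 2) / (2 * Real.cos (I t / 2))) t := by
    refine (((hΩd t).hasDerivAt.add (hσd t).hasDerivAt).div_const 2).congr_deriv ?_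
    rw [hσ, hΩ, hsin_eq, hcos_eq]
    field_simp
    rw [Real.sin_sq]
    ring
  have hadd : θ t + (Ω t + σ t) / 2 = (θ t + σ t) + (Ω t - σ t) / 2 := by ring
  have hsub : θ t - (Ω t - σ t) / 2 = (θ t + σ t) - (Ω t + σ t) / 2 := by ring
  have hcos_add := congrArg Real.cos hadd
  have hsin_add := congrArg Real.sin hadd
  have hcos_sub := congrArg Real.cos hsub
  have hsin_sub := congrArg Real.sin hsub
  rw [Real.cos_add, Real.cos_add (θ t + σ t)] at hcos_add
  rw [Real.sin_add, Real.sin_add (θ t + σ t)] at hsin_add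
  rw [Real.cos_sub, Real.cos_sub (θ t + σ t)] at hcos_sub
  rw [Real.sin_sub, Real.sin_sub (θ t + σ t)] at hsin_sub
  subst h1 h2 h3 h4
  refine ⟨(hhalf.sin.mul hdiff.cos).congr_deriv ?_, (hhalf.sin.mul hdiff.sin).congr_deriv ?_,
    (hhalf.cos.mul hsum.sin).congr_deriv ?_, (hhalf.cos.mul hsum.cos).congr_deriv ?_⟩
  · field_simp
    linear_combination -c t * hcos_add
  · field_simp
    linear_combination -c t * hsin_add
  · field_simp
    linear_combination -c t * hsin_sub
  · field_simp
    linear_combination c t * hcos_sub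
end

section
/- Let T, N, θ : ℝ → ℝ be functions, G : ℝ → ℝ differentiable with G(t) > 0 and Ġ = T, and λ₁, λ₂, λ₃, λ₄ : ℝ → ℝ differentiable satisfying λ̇₁ = (N/2)(λ₄ cos θ − λ₃ sin θ), λ̇₂ = (N/2)(λ₄ sin θ + λ₃ cos θ), λ̇₃ = (N/2)(λ₁ sin θ − λ₂ cos θ), λ̇₄ = −(N/2)(λ₁ cos θ + λ₂ sin θ). Define the scaled parameters gᵢ = √G · λᵢ for i = 1, …, 4. Then the gᵢ are differentiable and satisfy ġ₁ = (1/(2G))[T g₁ + G N (g₄ cos θ − g₃ sin θ)], ġ₂ = (1/(2G))[T g₂ + G N (g₄ sin θ + g₃ cos θ)], ġ₃ = (1/(2G))[T g₃ + G N (g₁ sin θ − g₂ cos θ)], ġ₄ = (1/(2G))[T g₄ − G N (g₁ cos θ + g₂ sin θ)]. -/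
/-- The derivative of `√G · l` at a point where `G` is positive, written over the common
denominator `2 G`. -/
theorem HasDerivAt.sqrt_mul {G l : ℝ → ℝ} {G' l' t : ℝ} (hG : HasDerivAt G G' t)
    (hl : HasDerivAt l l' t) (hpos : 0 < G t) :
    HasDerivAt (fun x => Real.sqrt (G x) * l x)
      (1 / (2 * G t) * (G' * (Real.sqrt (G t) * l t) + G t * (2 * Real.sqrt (G t) * l'))) t := by
  refine ((hG.sqrt hpos.ne').mul hl).congr_deriv ?_
  have hsqrt : Real.sqrt (G t) ≠ 0 := (Real.sqrt_pos.2 hpos).ne'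
  have hG_ne : G t ≠ 0 := hpos.ne'
  field_simp
  rw [Real.sq_sqrt hpos.le]
  ring


/-- The scaled Euler parameters `gᵢ = √G λᵢ` of the ideal frame formulation satisfy
`ġᵢ = (1/(2G))[T gᵢ + G N ( … )]`, where `Ġ = T` and the `λᵢ` satisfy the Euler-parameter
equations with coefficient `N`. -/
theorem scaledEulerParameters_hasDerivAt
    (T N θ : ℝ → ℝ) (G : ℝ → ℝ)
    (hGd : Differentiable ℝ G) (hGpos : ∀ t, 0 < G t)
    (hGT : ∀ t, deriv G t = T t)
    (l1 l2 l3 l4 : ℝ → ℝ)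
    (hd1 : Differentiable ℝ l1) (hd2 : Differentiable ℝ l2)
    (hd3 : Differentiable ℝ l3) (hd4 : Differentiable ℝ l4)
    (h1 : ∀ t, deriv l1 t = N t / 2 * (l4 t * Real.cos (θ t) - l3 t * Real.sin (θ t)))
    (h2 : ∀ t, deriv l2 t = N t / 2 * (l4 t * Real.sin (θ t) + l3 t * Real.cos (θ t)))
    (h3 : ∀ t, deriv l3 t = N t / 2 * (l1 t * Real.sin (θ t) - l2 t * Real.cos (θ t)))
    (h4 : ∀ t, deriv l4 t = -(N t / 2 * (l1 t * Real.cos (θ t) + l2 t * Real.sin (θ t))))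
    (g1 g2 g3 g4 : ℝ → ℝ)
    (hg1 : g1 = fun t => Real.sqrt (G t) * l1 t)
    (hg2 : g2 = fun t => Real.sqrt (G t) * l2 t)
    (hg3 : g3 = fun t => Real.sqrt (G t) * l3 t)
    (hg4 : g4 = fun t => Real.sqrt (G t) * l4 t) :
    ∀ t,
      HasDerivAt g1 (1 / (2 * G t) *
        (T t * g1 t + G t * N t * (g4 t * Real.cos (θ t) - g3 t * Real.sin (θ t)))) t ∧
      HasDerivAt g2 (1 / (2 * G t) *
        (T t * g2 t + G t * N t * (g4 t * Real.sin (θ t) + g3 t * Real.cos (θ t)))) t ∧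
      HasDerivAt g3 (1 / (2 * G t) *
        (T t * g3 t + G t * N t * (g1 t * Real.sin (θ t) - g2 t * Real.cos (θ t)))) t ∧
      HasDerivAt g4 (1 / (2 * G t) *
        (T t * g4 t - G t * N t * (g1 t * Real.cos (θ t) + g2 t * Real.sin (θ t)))) t := by
  subst hg1 hg2 hg3 hg4
  intro t
  have hG : HasDerivAt G (T t) t := hGT t ▸ (hGd t).hasDerivAt
  refine ⟨(hG.sqrt_mul (hd1 t).hasDerivAt (hGpos t)).congr_deriv ?_,
    (hG.sqrt_mul (hd2 t).hasDerivAt (hGpos t)).congr_deriv ?_,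
    (hG.sqrt_mul (hd3 t).hasDerivAt (hGpos t)).congr_deriv ?_,
    (hG.sqrt_mul (hd4 t).hasDerivAt (hGpos t)).congr_deriv ?_⟩
  · rw [h1]; ring
  · rw [h2]; ring
  · rw [h3]; ring
  · rw [h4]; ring
end

section
/- Let A, B, θ : ℝ → ℝ be functions and g₁, g₂, g₃, g₄ : ℝ → ℝ be differentiable functions such that G(t) := g₁² + g₂² + g₃² + g₄² > 0 and ġ₁ = (1/(2G))[A g₁ + B (g₄ cos θ − g₃ sin θ)], ġ₂ = (1/(2G))[A g₂ + B (g₄ sin θ + g₃ cos θ)], ġ₃ = (1/(2G))[A g₃ + B (g₁ sin θ − g₂ cos θ)], ġ₄ = (1/(2G))[A g₄ − B (g₁ cos θ + g₂ sin θ)]. Then d/dt (g₁² + g₂² + g₃² + g₄²) = A at every t. -/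
/-- In the scaled ideal frame formulation, the derived quantity
`G = g₁² + g₂² + g₃² + g₄²` automatically satisfies `Ġ = A`. -/
theorem scaledEulerParameters_sumSq_deriv
    (A B θ : ℝ → ℝ) (g1 g2 g3 g4 : ℝ → ℝ)
    (hd1 : Differentiable ℝ g1) (hd2 : Differentiable ℝ g2)
    (hd3 : Differentiable ℝ g3) (hd4 : Differentiable ℝ g4)
    (G : ℝ → ℝ)
    (hGdef : G = fun t => g1 t ^ 2 + g2 t ^ 2 + g3 t ^ 2 + g4 t ^ 2)
    (hGpos : ∀ t, 0 < G t)
    (h1 : ∀ t, deriv g1 t = 1 / (2 * G t) *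
      (A t * g1 t + B t * (g4 t * Real.cos (θ t) - g3 t * Real.sin (θ t))))
    (h2 : ∀ t, deriv g2 t = 1 / (2 * G t) *
      (A t * g2 t + B t * (g4 t * Real.sin (θ t) + g3 t * Real.cos (θ t))))
    (h3 : ∀ t, deriv g3 t = 1 / (2 * G t) *
      (A t * g3 t + B t * (g1 t * Real.sin (θ t) - g2 t * Real.cos (θ t))))
    (h4 : ∀ t, deriv g4 t = 1 / (2 * G t) *
      (A t * g4 t - B t * (g1 t * Real.cos (θ t) + g2 t * Real.sin (θ t)))) :
    ∀ t, HasDerivAt (fun s => g1 s ^ 2 + g2 s ^ 2 + g3 s ^ 2 + g4 s ^ 2) (A t) t := by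
  intro t
  have hG : G t = g1 t ^ 2 + g2 t ^ 2 + g3 t ^ 2 + g4 t ^ 2 := congrFun hGdef t
  have hne : G t ≠ 0 := (hGpos t).ne'
  have hderiv := ((((hd1 t).hasDerivAt.fun_pow 2).fun_add ((hd2 t).hasDerivAt.fun_pow 2)).fun_add
    ((hd3 t).hasDerivAt.fun_pow 2)).fun_add ((hd4 t).hasDerivAt.fun_pow 2)
  refine hderiv.congr_deriv ?_
  rw [h1, h2, h3, h4]
  field_simp
  rw [hG]
  norm_num
  ring
end
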